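/- arXiv:1407.8290 — 2 statements merged into one kernel-verified Lean document; each statement's English description precedes it below -/
import Mathlib

section
/- For every natural number n, n·|∫_{1}^{2} √(4 − x²) dx| = n·(2π/3 − √3/2). (This is the statement irr_k^c(C_n^→) = n·(2π/3 − √3/2) for the consecutively clockwise directed cycle C_n^→.) -/
/-- An antiderivative of `√(4 - x²)` on the open interval `(-2, 2)`. -/
theorem hasDerivAt_sqrt_four_sub_sq_primitive {x : ℝ} (hx : x ∈ Set.Ioo (-2 : ℝ) 2) :
    HasDerivAt (fun y : ℝ => y / 2 * Real.sqrt (4 - y ^ 2) + 2 * Real.arcsin (y / 2))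
      (Real.sqrt (4 - x ^ 2)) x := by
  obtain ⟨hl, hu⟩ := hx
  have hpos : 0 < 4 - x ^ 2 := by nlinarith
  have hs : 0 < Real.sqrt (4 - x ^ 2) := Real.sqrt_pos.mpr hpos
  have hsq : Real.sqrt (4 - x ^ 2) ^ 2 = 4 - x ^ 2 := Real.sq_sqrt hpos.le
  have hhalf : Real.sqrt (1 - (x / 2) ^ 2) = Real.sqrt (4 - x ^ 2) / 2 := by
    rw [Real.sqrt_eq_iff_mul_self_eq (by nlinarith) (by positivity)]
    nlinarith
  have hdiv : HasDerivAt (fun y : ℝ => y / 2) (1 / 2) x := (hasDerivAt_id x).div_const 2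
  have hsqrt : HasDerivAt (fun y : ℝ => Real.sqrt (4 - y ^ 2))
      (-(2 * x) / (2 * Real.sqrt (4 - x ^ 2))) x := by
    have hpoly : HasDerivAt (fun y : ℝ => 4 - y ^ 2) (-(2 * x)) x := by
      simpa using (hasDerivAt_pow 2 x).const_sub 4
    exact hpoly.sqrt hpos.ne'
  have harcsin : HasDerivAt (fun y : ℝ => Real.arcsin (y / 2))
      (1 / Real.sqrt (1 - (x / 2) ^ 2) * (1 / 2)) x :=
    (Real.hasDerivAt_arcsin (by linarith) (by linarith)).comp x hdiv
  refine ((hdiv.mul hsqrt).add (harcsin.const_mul 2)).congr_deriv ?_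
  rw [hhalf]
  field_simp
  linarith

theorem integral_sqrt_four_sub_sq_one_two :
    ∫ x in (1 : ℝ)..2, Real.sqrt (4 - x ^ 2) = 2 * Real.pi / 3 - Real.sqrt 3 / 2 := by
  have hcont : Continuous
      (fun y : ℝ => y / 2 * Real.sqrt (4 - y ^ 2) + 2 * Real.arcsin (y / 2)) := by
    fun_prop
  have hint : Continuous (fun y : ℝ => Real.sqrt (4 - y ^ 2)) := by fun_prop
  have harcsin : Real.arcsin (1 / 2) = Real.pi / 6 := by
    rw [← Real.sin_pi_div_six]
    exact Real.arcsin_sin (by linarith [Real.pi_pos]) (by linarith [Real.pi_pos])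
  rw [intervalIntegral.integral_eq_sub_of_hasDerivAt_of_le one_le_two hcont.continuousOn
    (fun x hx => hasDerivAt_sqrt_four_sub_sq_primitive ⟨by linarith [hx.1], hx.2⟩)
    (hint.intervalIntegrable 1 2), harcsin]
  norm_num
  ring

theorem khazamula_c_cycle (n : ℕ) :
    (n : ℝ) * |∫ x in (1:ℝ)..2, Real.sqrt (4 - x ^ 2)| =
      (n : ℝ) * (2 * Real.pi / 3 - Real.sqrt 3 / 2) := by
  rw [abs_of_nonneg (intervalIntegral.integral_nonneg one_le_two fun x _ => Real.sqrt_nonneg _),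
    integral_sqrt_four_sub_sq_one_two]
end

section
/- 4·∫_{-2}^{3} √(9 − x²) dx = 4·√5 + 9·π + 18·arcsin(2/3). (This is the statement irr_k^c(W_{(1,n)}^→) = 4√5 + 9π + 18·arcsin(2/3) for the directed wheel in the cases n = 3 and n = 4.) -/
/-- On `(-r, r)`, the function `(x √(r² - x²) + r² arcsin (x / r)) / 2` is an antiderivative of
`√(r² - x²)`. -/
theorem hasDerivAt_mul_sqrt_add_arcsin {r x : ℝ} (hr : 0 < r) (hx : x ∈ Set.Ioo (-r) r) :
    HasDerivAt (fun y => (y * Real.sqrt (r ^ 2 - y ^ 2) + r ^ 2 * Real.arcsin (y / r)) / 2)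
      (Real.sqrt (r ^ 2 - x ^ 2)) x := by
  obtain ⟨hx₁, hx₂⟩ := hx
  have hpos : 0 < r ^ 2 - x ^ 2 := by nlinarith
  have hlo : x / r ≠ -1 := by
    rw [ne_eq, div_eq_iff hr.ne']
    linarith
  have hhi : x / r ≠ 1 := by
    rw [ne_eq, div_eq_iff hr.ne']
    linarith
  have hsqrt : HasDerivAt (fun y => Real.sqrt (r ^ 2 - y ^ 2))
      (-(2 * x) / (2 * Real.sqrt (r ^ 2 - x ^ 2))) x := by
    have h : HasDerivAt (fun y : ℝ => r ^ 2 - y ^ 2) (-(2 * x)) x := by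
      simpa using (hasDerivAt_pow 2 x).const_sub (r ^ 2)
    exact h.sqrt hpos.ne'
  have harcsin : HasDerivAt (fun y => Real.arcsin (y / r))
      (1 / Real.sqrt (1 - (x / r) ^ 2) * (1 / r)) x :=
    HasDerivAt.comp (h₂ := Real.arcsin) x (Real.hasDerivAt_arcsin hlo hhi)
      ((hasDerivAt_id' x).div_const r)
  have hscale : Real.sqrt (1 - (x / r) ^ 2) = Real.sqrt (r ^ 2 - x ^ 2) / r := by
    rw [show 1 - (x / r) ^ 2 = (r ^ 2 - x ^ 2) / r ^ 2 by field_simp,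
      Real.sqrt_div hpos.le, Real.sqrt_sq hr.le]
  have hne : Real.sqrt (r ^ 2 - x ^ 2) ≠ 0 := (Real.sqrt_pos.2 hpos).ne'
  have hsq := Real.sq_sqrt hpos.le
  refine ((((hasDerivAt_id x).mul hsqrt).add (harcsin.const_mul (r ^ 2))).div_const 2).congr_deriv ?_
  rw [hscale]
  simp only [id]
  field_simp
  linarith

/-- The area under the semicircle of radius `r` between two abscissae. -/
theorem integral_sqrt_sq_sub_sq {r a b : ℝ} (hr : 0 < r) (ha : -r ≤ a) (hab : a ≤ b)
    (hb : b ≤ r) :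
    ∫ x in a..b, Real.sqrt (r ^ 2 - x ^ 2) =
      (b * Real.sqrt (r ^ 2 - b ^ 2) + r ^ 2 * Real.arcsin (b / r)) / 2 -
        (a * Real.sqrt (r ^ 2 - a ^ 2) + r ^ 2 * Real.arcsin (a / r)) / 2 := by
  refine intervalIntegral.integral_eq_sub_of_hasDerivAt_of_le hab
    (f := fun y => (y * Real.sqrt (r ^ 2 - y ^ 2) + r ^ 2 * Real.arcsin (y / r)) / 2) ?_
    (fun x hx => hasDerivAt_mul_sqrt_add_arcsin hr
      ⟨ha.trans_lt hx.1, hx.2.trans_le hb⟩) ?_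
  · exact Continuous.continuousOn (by fun_prop)
  · exact Continuous.intervalIntegrable (by fun_prop) _ _

theorem khazamula_c_wheel_small :
    4 * ∫ x in (-2:ℝ)..3, Real.sqrt (9 - x ^ 2) =
      4 * Real.sqrt 5 + 9 * Real.pi + 18 * Real.arcsin (2 / 3) := by
  have h := integral_sqrt_sq_sub_sq (r := 3) (a := -2) (b := 3) (by norm_num) (by norm_num)
    (by norm_num) le_rfl
  norm_num [neg_div, Real.arcsin_neg] at h
  rw [h]
  ring
end
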